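/- Let 1 < r < ∞ and let (f_n)_{n≥1} be a sequence of measurable functions on ℝ^d such that (Σ_{n=1}^∞ |f_n(·)|^r)^{1/r} ∈ L^1(μ_κ). Then for every λ > 0, μ_κ({x ∈ ℝ^d : (Σ_{n=1}^∞ |M_κ^R f_n(x)|^r)^{1/r} > λ}) ≤ (C/λ) ‖(Σ_{n=1}^∞ |f_n(·)|^r)^{1/r}‖_{κ,1}, where C = C(κ_1,…,κ_d,r) is independent of (f_n) and λ. -/

import Mathlib

noncomputable section
open MeasureTheory Set Real
open scoped ENNReal NNReal

/-- one-dimensional measure `dμ_κ(x) = |x|^{2κ} dx` -/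
def muK1 (κ : ℝ) : Measure ℝ :=
  volume.withDensity fun x => ENNReal.ofReal (|x| ^ (2 * κ))

/-- the measure `μ_κ` on `ℝ^d` with density `∏_j |x_j|^{2κ_j}` -/
def muK (d : ℕ) (κ : Fin d → ℝ) : Measure (Fin d → ℝ) :=
  volume.withDensity fun x => ENNReal.ofReal (∏ j, |x j| ^ (2 * κ j))

/-- the constant `M_κ = Γ(κ+1/2)/(Γ(κ)Γ(1/2))` -/
def Mconst (κ : ℝ) : ℝ := Real.Gamma (κ + 1/2) / (Real.Gamma κ * Real.Gamma (1/2))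

/-- `σ_{x,y,z}` -/
def sigma3 (x y z : ℝ) : ℝ := if x ≠ 0 ∧ y ≠ 0 then (x^2 + y^2 - z^2) / (2*x*y) else 0

/-- area of the (possibly degenerate) triangle with side lengths `x,y,z` (Heron) -/
def triArea (x y z : ℝ) : ℝ :=
  Real.sqrt (((x+y+z)/2) * ((x+y+z)/2 - x) * ((x+y+z)/2 - y) * ((x+y+z)/2 - z))

/-- the kernel `K_κ(x,y,z)` -/
def Kker (κ x y z : ℝ) : ℝ :=
  if |x - y| ≤ z ∧ z ≤ x + y then
    (2:ℝ) ^ (2*κ - 2) * Mconst κ * triArea x y z ^ (2*κ - 2) * (x*y*z) ^ (1 - 2*κ)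
  else 0

/-- density of the measure `ν^{κ,+}_{x,y}` with respect to Lebesgue measure -/
def nuDens (κ x y z : ℝ) : ℝ≥0∞ :=
  ENNReal.ofReal ((1/2) * Kker κ |x| |y| |z| * (1 - sigma3 x y z) * |z| ^ (2*κ))

/-- the measure `ν^{κ,+}_{x,y}` -/
def nuPlus (κ x y : ℝ) : Measure ℝ := volume.withDensity (nuDens κ x y)

/-- the product measure `υ^κ_{x,y} = ν^{κ_1,+}_{x_1,y_1} ⊗ ⋯ ⊗ ν^{κ_d,+}_{x_d,y_d}` -/
def upsilon (d : ℕ) (κ x y : Fin d → ℝ) : Measure (Fin d → ℝ) :=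
  volume.withDensity fun z => ∏ j, nuDens (κ j) (x j) (y j) (z j)

/-- the set `ℝ^d_reg` of regular points -/
def regSet (d : ℕ) : Set (Fin d → ℝ) := {x | ∀ j, x j ≠ 0}

/-- the Euclidean ball of radius `r` centered at the origin -/
def eBall (d : ℕ) (r : ℝ) : Set (Fin d → ℝ) := {x | ∑ j, (x j)^2 < r^2}

/-- the open cube `Q_r` -/
def cubeQ (d : ℕ) (r : ℝ) : Set (Fin d → ℝ) := {x | ∀ j, |x j| < r}

/-- the constant `c_κ` with `c_κ⁻¹ = ∫ e^{-‖x‖²/2} dμ_κ` -/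
def cKappa (d : ℕ) (κ : Fin d → ℝ) : ℝ :=
  (∫ x, Real.exp (-(∑ j, (x j)^2) / 2) ∂(muK d κ))⁻¹

open Classical in
/-- the `ℤ_2^d` Dunkl maximal operator (explicit form), vanishing off `ℝ^d_reg` -/
def Mdunkl (d : ℕ) (κ : Fin d → ℝ) (f : (Fin d → ℝ) → ℝ) (x : Fin d → ℝ) : ℝ≥0∞ :=
  if x ∈ regSet d then
    ⨆ (r : ℝ) (_ : 0 < r), ENNReal.ofReal
      ((cKappa d κ / (muK d κ (eBall d r)).toReal) *
        |∫ y in regSet d, f y * (upsilon d κ x (-y) (eBall d r)).toReal ∂(muK d κ)|)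
  else 0

/-- the cube Dunkl maximal operator `M_κ^Q` (explicit form) -/
def MdunklQ (d : ℕ) (κ : Fin d → ℝ) (f : (Fin d → ℝ) → ℝ) (x : Fin d → ℝ) : ℝ≥0∞ :=
  ⨆ (r : ℝ) (_ : 0 < r), ENNReal.ofReal
    ((cKappa d κ / (muK d κ (cubeQ d r)).toReal) *
      |∫ y in regSet d, f y * (upsilon d κ x (-y) (cubeQ d r)).toReal ∂(muK d κ)|)

/-- the interval `I(x,r) = [max{0,|x|-r}, |x|+r)` -/
def Iset (x r : ℝ) : Set ℝ := Set.Ico (max 0 (|x| - r)) (|x| + r)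

/-- the rectangle `R(z,r) = I(z_1,r) × ⋯ × I(z_d,r)` -/
def Rset (d : ℕ) (z : Fin d → ℝ) (r : ℝ) : Set (Fin d → ℝ) :=
  Set.univ.pi fun j => Iset (z j) r

/-- the weighted maximal operator `M_κ^R` -/
def MR (d : ℕ) (κ : Fin d → ℝ) (f : (Fin d → ℝ) → ℝ) (x : Fin d → ℝ) : ℝ≥0∞ :=
  ⨆ (r : ℝ) (_ : 0 < r),
    (muK d κ (Rset d x r))⁻¹ *
      ∫⁻ y in {y | (fun j => |y j|) ∈ Rset d x r}, ENNReal.ofReal |f y| ∂(muK d κ)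

/-- Rösler's explicit formula for the one-dimensional Dunkl translation `τ_x^κ f(y)` -/
def tauK (κ x : ℝ) (f : ℝ → ℝ) (y : ℝ) : ℝ :=
  (1/2) * (∫ t in Set.Ioo (-1:ℝ) 1,
      f (Real.sqrt (x^2 + y^2 + 2*x*y*t)) *
        (1 + (x + y) / Real.sqrt (x^2 + y^2 + 2*x*y*t)) *
        (Mconst κ * (1 + t) * (1 - t^2) ^ (κ - 1)))
  + (1/2) * (∫ t in Set.Ioo (-1:ℝ) 1,
      f (-Real.sqrt (x^2 + y^2 + 2*x*y*t)) *
        (1 - (x + y) / Real.sqrt (x^2 + y^2 + 2*x*y*t)) *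
        (Mconst κ * (1 + t) * (1 - t^2) ^ (κ - 1)))

/-- an `ℝ≥0∞`-valued `L^p` norm for `ℝ≥0∞`-valued functions -/
def lpNormE {α : Type*} [MeasurableSpace α] (g : α → ℝ≥0∞) (p : ℝ≥0∞) (μ : Measure α) : ℝ≥0∞ :=
  if p = ∞ then essSup g μ else (∫⁻ x, g x ^ p.toReal ∂μ) ^ (1 / p.toReal)

/-- the Hardy–Littlewood maximal operator over cubes centered at `x` -/
def HLmax (d : ℕ) (f : (Fin d → ℝ) → ℝ) (x : Fin d → ℝ) : ℝ≥0∞ :=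
  ⨆ (r : ℝ) (_ : 0 < r),
    (volume {y : Fin d → ℝ | ∀ j, |y j - x j| < r})⁻¹ *
      ∫⁻ y in {y : Fin d → ℝ | ∀ j, |y j - x j| < r}, ENNReal.ofReal |f y| ∂volume

/-! ### Power integrals -/

section PowerIntegrals

theorem ennreal_rpow_le_two_rpow_mul_lintegral (a : ℝ≥0∞) {r : ℝ} (hr : 1 ≤ r) :
    a ^ r ≤ 2 ^ r * ∫⁻ t in Ioi (0 : ℝ),
      {t : ℝ | ENNReal.ofReal t < a}.indicator (fun t => ENNReal.ofReal t ^ (r - 1)) t := by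
  set I := ∫⁻ t in Ioi (0 : ℝ),
      {t : ℝ | ENNReal.ofReal t < a}.indicator (fun t => ENNReal.ofReal t ^ (r - 1)) t
  have hr0 : 0 < r := by linarith
  have key : ∀ b : ℝ≥0, (b : ℝ≥0∞) ≤ a → (b / 2 : ℝ≥0∞) ^ r ≤ I := by
    intro b hb
    rcases eq_or_ne b 0 with rfl | hb0
    · simp [hr0]
    have hbpos : (0 : ℝ) < b := by positivity
    have hmeas : ENNReal.ofReal ((b : ℝ) - b / 2) = (b / 2 : ℝ≥0∞) := by
      rw [sub_half, ENNReal.ofReal_div_of_pos two_pos]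
      simp
    calc (b / 2 : ℝ≥0∞) ^ r = (b / 2 : ℝ≥0∞) ^ (r - 1) * (b / 2) := by
          have h0 : (b / 2 : ℝ≥0∞) ≠ 0 := by simp [hb0]
          have h1 : (b / 2 : ℝ≥0∞) ≠ ∞ := ENNReal.div_ne_top (by simp) (by simp)
          conv_lhs => rw [← sub_add_cancel r 1, ENNReal.rpow_add _ _ h0 h1, ENNReal.rpow_one]
      _ = ∫⁻ _ in Ioo (b / 2 : ℝ) b, (b / 2 : ℝ≥0∞) ^ (r - 1) := by
          rw [setLIntegral_const, Real.volume_Ioo, hmeas]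
      _ ≤ ∫⁻ t in Ioo (b / 2 : ℝ) b, {t : ℝ | ENNReal.ofReal t < a}.indicator
            (fun t => ENNReal.ofReal t ^ (r - 1)) t := by
          refine setLIntegral_mono' measurableSet_Ioo fun t ht => ?_
          have : ENNReal.ofReal t < a := by
            refine lt_of_lt_of_le ?_ hb
            rw [ENNReal.ofReal_lt_iff_lt_toReal (by linarith [ht.1]) (by simp)]
            exact ht.2
          rw [indicator_of_mem (by exact this)]
          refine ENNReal.rpow_le_rpow ?_ (by linarith)
          rw [← hmeas, sub_half]
          exact ENNReal.ofReal_le_ofReal ht.1.le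
      _ ≤ I := lintegral_mono_set fun t ht => lt_trans (by positivity) ht.1
  have h2 : (a / 2) ^ r ≤ I := by
    rw [← ENNReal.le_rpow_inv_iff hr0, ENNReal.div_le_iff (by simp) (by simp)]
    refine ENNReal.le_of_forall_nnreal_lt fun b hb => ?_
    rw [← ENNReal.div_le_iff (by simp) (by simp), ENNReal.le_rpow_inv_iff hr0]
    exact key b hb.le
  calc a ^ r = (2 * (a / 2)) ^ r := by rw [ENNReal.mul_div_cancel (by simp) (by simp)]
    _ = 2 ^ r * (a / 2) ^ r := ENNReal.mul_rpow_of_nonneg _ _ hr0.le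
    _ ≤ _ := by gcongr

theorem lintegral_indicator_ofReal_rpow_le (b : ℝ≥0∞) {r : ℝ} (hr : 1 < r) :
    ∫⁻ t in Ioi (0 : ℝ),
      {t : ℝ | ENNReal.ofReal t < b}.indicator (fun t => ENNReal.ofReal t ^ (r - 2)) t ≤
      ENNReal.ofReal (1 / (r - 1)) * b ^ (r - 1) := by
  have hr1 : 0 < r - 1 := by linarith
  rcases eq_or_ne b ∞ with rfl | hb
  · rw [ENNReal.top_rpow_of_pos hr1, ENNReal.mul_top]
    · exact le_top
    · simpa using hr1
  lift b to ℝ≥0 using hb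
  refine le_of_eq ?_
  calc _ = ∫⁻ t in Ioo (0 : ℝ) b, ENNReal.ofReal (t ^ (r - 2)) := by
        rw [← lintegral_indicator measurableSet_Ioi, ← lintegral_indicator measurableSet_Ioo]
        congr 1 with t
        by_cases h0 : 0 < t
        · rw [indicator_of_mem (by exact h0)]
          simp only [indicator_apply, mem_ofPred_eq,
            ENNReal.ofReal_lt_iff_lt_toReal h0.le ENNReal.coe_ne_top,
            ENNReal.coe_toReal, mem_Ioo, h0, true_and, ENNReal.ofReal_rpow_of_pos h0]
        · rw [indicator_of_notMem (by exact h0), indicator_of_notMem (fun h => h0 h.1)]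
    _ = ENNReal.ofReal (∫ t in Ioo (0 : ℝ) b, t ^ (r - 2)) := by
        rw [ofReal_integral_eq_lintegral_ofReal]
        · exact (intervalIntegrable_iff_integrableOn_Ioo_of_le b.2).1
            (intervalIntegral.intervalIntegrable_rpow' (by linarith))
        · refine (ae_restrict_iff' measurableSet_Ioo).2 (ae_of_all _ fun t ht => ?_)
          exact Real.rpow_nonneg ht.1.le _
    _ = ENNReal.ofReal (1 / (r - 1)) * b ^ (r - 1) := by
        rw [← integral_Ioc_eq_integral_Ioo, ← intervalIntegral.integral_of_le b.coe_nonneg,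
          integral_rpow (Or.inl (by linarith))]
        have : r - 2 + 1 = r - 1 := by ring
        rw [this, Real.zero_rpow hr1.ne', sub_zero, div_eq_mul_one_div, mul_comm,
          ENNReal.ofReal_mul (by positivity), ← ENNReal.ofReal_rpow_of_nonneg b.coe_nonneg hr1.le,
          ENNReal.ofReal_coe_nnreal]

/-- Minkowski's integral inequality for sequences. -/
theorem tsum_lintegral_rpow_le {α : Type*} [MeasurableSpace α] {μ : Measure α}
    {g : ℕ → α → ℝ≥0∞} (hg : ∀ n, Measurable (g n)) {r : ℝ} (hr : 1 < r) :
    ∑' n, (∫⁻ x, g n x ∂μ) ^ r ≤ (∫⁻ x, (∑' n, g n x ^ r) ^ (1 / r) ∂μ) ^ r := by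
  have hr0 : 0 < r := by linarith
  have hr1 : 0 < r - 1 := by linarith
  set J := ∫⁻ x, (∑' n, g n x ^ r) ^ (1 / r) ∂μ with hJ
  have hgF : ∀ n x, g n x ≤ (∑' n, g n x ^ r) ^ (1 / r) := fun n x => by
    rw [one_div, ENNReal.le_rpow_inv_iff hr0]
    exact ENNReal.le_tsum n
  by_cases hJtop : J = ∞
  · rw [hJtop, ENNReal.top_rpow_of_pos hr0]
    exact le_top
  refine ENNReal.tsum_le_of_sum_range_le fun N => ?_
  set a : ℕ → ℝ≥0∞ := fun n => ∫⁻ x, g n x ∂μ with ha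
  have ha_top : ∀ n, a n ≠ ∞ := fun n => ne_top_of_le_ne_top hJtop (lintegral_mono (hgF n))
  set S := ∑ n ∈ Finset.range N, a n ^ r with hS
  have hStop : S ≠ ∞ := ENNReal.sum_ne_top.2 fun n _ =>
    ENNReal.rpow_ne_top_of_nonneg hr0.le (ha_top n)
  rcases eq_or_ne S 0 with hS0 | hS0
  · rw [hS0]; exact zero_le
  have hpq : (r / (r - 1)).HolderConjugate r := (Real.HolderConjugate.conjExponent hr).symm
  have hexp : 1 / (r / (r - 1)) = 1 - 1 / r := by
    field_simp
  have hmain : S ≤ S ^ (1 - 1 / r) * J := by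
    calc S = ∑ n ∈ Finset.range N, ∫⁻ x, a n ^ (r - 1) * g n x ∂μ := by
          refine Finset.sum_congr rfl fun n _ => ?_
          rw [lintegral_const_mul _ (hg n)]
          change a n ^ r = a n ^ (r - 1) * a n
          rcases eq_or_ne (a n) 0 with h0 | h0
          · rw [h0, ENNReal.zero_rpow_of_pos hr0, mul_zero]
          · conv_lhs => rw [← sub_add_cancel r 1, ENNReal.rpow_add _ _ h0 (ha_top n),
              ENNReal.rpow_one]
      _ = ∫⁻ x, ∑ n ∈ Finset.range N, a n ^ (r - 1) * g n x ∂μ :=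
          (lintegral_finsetSum _ fun n _ => (hg n).const_mul _).symm
      _ ≤ ∫⁻ x, S ^ (1 - 1 / r) * (∑' n, g n x ^ r) ^ (1 / r) ∂μ := by
          refine lintegral_mono fun x => ?_
          refine (ENNReal.inner_le_Lp_mul_Lq (Finset.range N) _ _ hpq).trans ?_
          rw [hexp]
          have : ∀ n, (a n ^ (r - 1)) ^ (r / (r - 1)) = a n ^ r := fun n => by
            rw [← ENNReal.rpow_mul]
            congr 1
            field_simp
          simp only [this]
          gcongr
          exact ENNReal.sum_le_tsum _
      _ = S ^ (1 - 1 / r) * J := by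
          rw [lintegral_const_mul]
          exact (Measurable.tsum fun n => (hg n).pow_const _).pow_const _
  have hS1 : S ^ (1 / r) ≤ J := by
    have h1 : S ^ (1 - 1 / r) ≠ 0 := (ENNReal.rpow_pos (pos_iff_ne_zero.2 hS0) hStop).ne'
    have h2 : S ^ (1 - 1 / r) ≠ ∞ := ENNReal.rpow_ne_top_of_ne_zero hS0 hStop
    refine (ENNReal.mul_le_mul_iff_right h1 h2).1 ?_
    rw [← ENNReal.rpow_add _ _ hS0 hStop, sub_add_cancel, ENNReal.rpow_one]
    exact hmain
  rwa [one_div, ENNReal.rpow_inv_le_iff hr0] at hS1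

end PowerIntegrals

/-! ### Maximal functions on spaces of homogeneous type -/

section Doubling

open Metric Filter Topology

variable {X : Type*} [MetricSpace X] [MeasurableSpace X]

/-- `μ` is globally doubling with constant `A`, balls have positive finite measure, and the measure
of balls tends to infinity with the radius, uniformly in the centre. -/
structure GloballyDoubling (μ : Measure X) (A : ℝ≥0) : Prop where
  doubling : ∀ x s, 0 < s → μ (ball x (2 * s)) ≤ A * μ (ball x s)
  pos : ∀ x s, 0 < s → 0 < μ (ball x s)
  finite : ∀ x s, μ (ball x s) < ∞
  growth : ∀ K : ℝ≥0∞, K < ∞ → ∃ R : ℝ, ∀ x s, R < s → K < μ (ball x s)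

/-- The uncentered maximal function over open balls. -/
def uncenteredMax (μ : Measure X) (g : X → ℝ≥0∞) (x : X) : ℝ≥0∞ :=
  ⨆ (y : X) (s : ℝ) (_ : 0 < s),
    (ball y s).indicator (fun _ => (μ (ball y s))⁻¹ * ∫⁻ z in ball y s, g z ∂μ) x

theorem lowerSemicontinuous_uncenteredMax (μ : Measure X) (g : X → ℝ≥0∞) :
    LowerSemicontinuous (uncenteredMax μ g) :=
  lowerSemicontinuous_iSup fun _ => lowerSemicontinuous_iSup fun _ =>
    lowerSemicontinuous_iSup fun _ => isOpen_ball.lowerSemicontinuous_indicator zero_le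

theorem isOpen_lt_uncenteredMax (μ : Measure X) (g : X → ℝ≥0∞) (t : ℝ≥0∞) :
    IsOpen {x | t < uncenteredMax μ g x} :=
  (lowerSemicontinuous_uncenteredMax μ g).isOpen_preimage t

theorem measurable_uncenteredMax [BorelSpace X] (μ : Measure X) (g : X → ℝ≥0∞) :
    Measurable (uncenteredMax μ g) :=
  (lowerSemicontinuous_uncenteredMax μ g).measurable

theorem le_uncenteredMax (μ : Measure X) (g : X → ℝ≥0∞) {x y : X} {s : ℝ} (hx : x ∈ ball y s) :
    (μ (ball y s))⁻¹ * ∫⁻ z in ball y s, g z ∂μ ≤ uncenteredMax μ g x := by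
  have hs : 0 < s := pos_of_mem_ball hx
  refine le_iSup_of_le y (le_iSup_of_le s (le_iSup_of_le hs ?_))
  rw [indicator_of_mem hx]

theorem uncenteredMax_le_iff {μ : Measure X} {g : X → ℝ≥0∞} {x : X} {b : ℝ≥0∞} :
    uncenteredMax μ g x ≤ b ↔
      ∀ y s, x ∈ ball y s → (μ (ball y s))⁻¹ * ∫⁻ z in ball y s, g z ∂μ ≤ b := by
  refine ⟨fun h y s hx => (le_uncenteredMax μ g hx).trans h, fun h => ?_⟩
  refine iSup_le fun y => iSup_le fun s => iSup_le fun _ => ?_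
  by_cases hx : x ∈ ball y s
  · rw [indicator_of_mem hx]
    exact h y s hx
  · rw [indicator_of_notMem hx]
    exact zero_le

theorem exists_ball_of_lt_uncenteredMax {μ : Measure X} {g : X → ℝ≥0∞} {x : X} {t : ℝ≥0∞}
    (h : t < uncenteredMax μ g x) :
    ∃ y s, x ∈ ball y s ∧ t < (μ (ball y s))⁻¹ * ∫⁻ z in ball y s, g z ∂μ := by
  by_contra! hcon
  exact h.not_ge (uncenteredMax_le_iff.2 hcon)

namespace GloballyDoubling

variable {μ : Measure X} {A : ℝ≥0}

theorem measure_ball_pow_le (h : GloballyDoubling μ A) (x : X) {s : ℝ} (hs : 0 < s) (n : ℕ) :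
    μ (ball x (2 ^ n * s)) ≤ (A : ℝ≥0∞) ^ n * μ (ball x s) := by
  induction n with
  | zero => simp
  | succ n ih =>
    calc μ (ball x (2 ^ (n + 1) * s)) = μ (ball x (2 * (2 ^ n * s))) := by ring_nf
      _ ≤ A * μ (ball x (2 ^ n * s)) := h.doubling _ _ (by positivity)
      _ ≤ A * (A ^ n * μ (ball x s)) := by gcongr
      _ = _ := by ring

theorem isUnifLocDoublingMeasure (h : GloballyDoubling μ A) : IsUnifLocDoublingMeasure μ := by
  refine ⟨A ^ 2, ?_⟩
  filter_upwards [self_mem_nhdsWithin] with ε (hε : 0 < ε) x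
  calc μ (closedBall x (2 * ε)) ≤ μ (ball x (2 ^ 2 * ε)) :=
        measure_mono (closedBall_subset_ball (by linarith))
    _ ≤ (A : ℝ≥0∞) ^ 2 * μ (ball x ε) := h.measure_ball_pow_le x hε 2
    _ ≤ _ := by
      push_cast
      gcongr
      exact ball_subset_closedBall

theorem isLocallyFiniteMeasure (h : GloballyDoubling μ A) : IsLocallyFiniteMeasure μ :=
  ⟨fun x => ⟨ball x 1, ball_mem_nhds x one_pos, h.finite x 1⟩⟩

theorem mul_measure_ball_lt (h : GloballyDoubling μ A) {y : X} {s : ℝ} (hs : 0 < s) {t I : ℝ≥0∞}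
    (hlt : t < (μ (ball y s))⁻¹ * I) : t * μ (ball y s) < I := by
  rwa [mul_comm _ I, ← div_eq_mul_inv,
    ENNReal.lt_div_iff_mul_lt (Or.inl (h.pos y s hs).ne') (Or.inl (h.finite y s).ne)] at hlt

theorem one_le [Nonempty X] (h : GloballyDoubling μ A) : 1 ≤ A := by
  obtain ⟨x⟩ := ‹Nonempty X›
  have h1 := h.doubling x 1 one_pos
  have h2 : 1 * μ (ball x 1) ≤ A * μ (ball x 1) := by
    rw [one_mul]
    exact (measure_mono (ball_subset_ball (by norm_num))).trans h1
  have := (ENNReal.mul_le_mul_iff_left (h.pos x 1 one_pos).ne' (h.finite x 1).ne).1 h2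
  exact_mod_cast this

variable [BorelSpace X] [SecondCountableTopology X]

/-- Weak type `(1,1)` of the uncentered maximal function. -/
theorem measure_lt_uncenteredMax_le (h : GloballyDoubling μ A) (hA : 1 ≤ A) (g : X → ℝ≥0∞)
    {t : ℝ≥0∞} (ht : t ≠ 0) (ht' : t ≠ ∞) :
    μ {x | t < uncenteredMax μ g x} ≤ (A : ℝ≥0∞) ^ 3 / t * ∫⁻ x, g x ∂μ := by
  have hA0 : (A : ℝ≥0∞) ≠ 0 := by
    have : A ≠ 0 := (zero_lt_one.trans_le hA).ne'
    exact_mod_cast this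
  by_cases hg : ∫⁻ x, g x ∂μ = ∞
  · rw [hg, ENNReal.mul_top]
    · exact le_top
    · exact (ENNReal.div_pos (pow_ne_zero _ hA0) ht').ne'
  let T : Set (X × ℝ) := {p | 0 < p.2 ∧ t * μ (ball p.1 p.2) < ∫⁻ z in ball p.1 p.2, g z ∂μ}
  obtain ⟨R, hR⟩ := h.growth ((∫⁻ x, g x ∂μ) / t) (ENNReal.div_lt_top hg ht)
  have hTR : ∀ p ∈ T, p.2 ≤ R := by
    intro p hp
    by_contra! hlt
    have h1 := hR p.1 p.2 hlt
    rw [ENNReal.div_lt_iff (Or.inl ht) (Or.inl ht'), mul_comm] at h1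
    exact (h1.trans hp.2).not_ge (setLIntegral_le_lintegral _ _)
  obtain ⟨u, huT, hdisj, hcov⟩ := Vitali.exists_disjoint_subfamily_covering_enlargement_closedBall
    T (fun p => p.1) (fun p => p.2) R hTR 4 (by norm_num)
  have hucount : u.Countable := hdisj.countable_of_nonempty_interior fun p hp =>
    ⟨p.1, ball_subset_interior_closedBall (mem_ball_self (huT hp).1)⟩
  have hsub : {x | t < uncenteredMax μ g x} ⊆ ⋃ p ∈ u, ball p.1 (2 ^ 3 * p.2) := by
    intro x hx
    obtain ⟨y, s, hxs, hlt⟩ := exists_ball_of_lt_uncenteredMax hx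
    have hs : 0 < s := pos_of_mem_ball hxs
    obtain ⟨p, hpu, hp⟩ := hcov (y, s) ⟨hs, h.mul_measure_ball_lt hs hlt⟩
    refine mem_iUnion₂.2 ⟨p, hpu, ?_⟩
    refine closedBall_subset_ball ?_ (hp (ball_subset_closedBall hxs))
    linarith [(huT hpu).1]
  have := hucount.to_subtype
  calc μ {x | t < uncenteredMax μ g x} ≤ ∑' p : u, μ (ball p.1.1 (2 ^ 3 * p.1.2)) :=
        (measure_mono hsub).trans (measure_biUnion_le _ hucount _)
    _ ≤ ∑' p : u, (A : ℝ≥0∞) ^ 3 / t * ∫⁻ z in ball p.1.1 p.1.2, g z ∂μ := by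
      refine ENNReal.tsum_le_tsum fun p => ?_
      refine (h.measure_ball_pow_le _ (huT p.2).1 3).trans ?_
      rw [div_eq_mul_inv, mul_assoc]
      gcongr
      rw [mul_comm, ← div_eq_mul_inv, ENNReal.le_div_iff_mul_le (Or.inl ht) (Or.inl ht'), mul_comm]
      exact (huT p.2).2.le
    _ = (A : ℝ≥0∞) ^ 3 / t * ∫⁻ z in ⋃ p ∈ u, ball p.1 p.2, g z ∂μ := by
      rw [ENNReal.tsum_mul_left, lintegral_biUnion hucount (fun _ _ => measurableSet_ball)
        (hdisj.mono fun _ => ball_subset_closedBall)]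
    _ ≤ _ := by
      gcongr
      exact Measure.restrict_le_self

omit [BorelSpace X] in
theorem sigmaFinite (h : GloballyDoubling μ A) : SigmaFinite μ :=
  have := h.isLocallyFiniteMeasure
  inferInstance

theorem measure_lt_uncenteredMax_le_truncation (h : GloballyDoubling μ A) (hA : 1 ≤ A)
    (g : X → ℝ≥0∞) {t : ℝ≥0∞} (ht : t ≠ 0) (ht' : t ≠ ∞) :
    μ {x | t < uncenteredMax μ g x} ≤
      (A : ℝ≥0∞) ^ 3 / (t / 2) * ∫⁻ x, {x | t < 2 * g x}.indicator g x ∂μ := by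
  set g₁ : X → ℝ≥0∞ := {x | t < 2 * g x}.indicator g with hg₁
  have ht2 : t / 2 ≠ 0 := by simp [ht]
  have ht2' : t / 2 ≠ ∞ := ENNReal.div_ne_top ht' (by simp)
  refine (measure_mono fun x hx => ?_).trans (h.measure_lt_uncenteredMax_le hA g₁ ht2 ht2')
  by_contra hle
  have hle : uncenteredMax μ g₁ x ≤ t / 2 := not_lt.1 hle
  have hx : t < uncenteredMax μ g x := hx
  refine hx.not_ge (uncenteredMax_le_iff.2 fun y s hxs => ?_)
  have hs : 0 < s := pos_of_mem_ball hxs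
  have hgle : ∀ z, g z ≤ g₁ z + t / 2 := fun z => by
    by_cases hz : t < 2 * g z
    · rw [hg₁, indicator_of_mem (by exact hz)]
      exact le_self_add
    · refine le_add_left ?_
      rw [ENNReal.le_div_iff_mul_le (by simp) (by simp), mul_comm]
      exact not_lt.1 hz
  calc (μ (ball y s))⁻¹ * ∫⁻ z in ball y s, g z ∂μ
      ≤ (μ (ball y s))⁻¹ * ∫⁻ z in ball y s, (g₁ z + t / 2) ∂μ := by
        gcongr with z
        exact hgle z
    _ = (μ (ball y s))⁻¹ * ∫⁻ z in ball y s, g₁ z ∂μ + t / 2 := by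
        rw [lintegral_add_right _ measurable_const, setLIntegral_const, mul_add,
          mul_comm (t / 2), ← mul_assoc,
          ENNReal.inv_mul_cancel (h.pos y s hs).ne' (h.finite y s).ne, one_mul]
    _ ≤ t / 2 + t / 2 := by
        gcongr
        exact (le_uncenteredMax μ g₁ hxs).trans hle
    _ = t := ENNReal.add_halves t

/-- The constant in the strong type `(r,r)` inequality. -/
def strongTypeConst (A : ℝ≥0) (r : ℝ) : ℝ≥0∞ :=
  2 ^ r * (A ^ 3 * 2) * (ENNReal.ofReal (1 / (r - 1)) * 2 ^ (r - 1))

omit [BorelSpace X] [SecondCountableTopology X] in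
theorem strongTypeConst_ne_top (A : ℝ≥0) (r : ℝ) : strongTypeConst A r ≠ ∞ := by
  unfold strongTypeConst
  refine ENNReal.mul_ne_top (ENNReal.mul_ne_top ?_ ?_) (ENNReal.mul_ne_top (by simp) ?_)
  · exact ENNReal.rpow_ne_top_of_ne_zero (by simp) (by simp)
  · exact ENNReal.mul_ne_top (by simp) (by simp)
  · exact ENNReal.rpow_ne_top_of_ne_zero (by simp) (by simp)

/-- Strong type `(r,r)` of the uncentered maximal function. -/
theorem lintegral_rpow_uncenteredMax_le (h : GloballyDoubling μ A) (hA : 1 ≤ A)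
    {g : X → ℝ≥0∞} (hg : Measurable g) {r : ℝ} (hr : 1 < r) :
    ∫⁻ x, uncenteredMax μ g x ^ r ∂μ ≤ strongTypeConst A r * ∫⁻ x, g x ^ r ∂μ := by
  have := h.sigmaFinite
  have hr1 : 0 < r - 1 := by linarith
  set M := uncenteredMax μ g with hM
  have hMmeas : Measurable M := measurable_uncenteredMax μ g
  have hpow : ∀ e : ℝ, Measurable fun t : ℝ => ENNReal.ofReal t ^ e := fun e =>
    ENNReal.measurable_ofReal.pow_const e
  have hind : ∀ {G : X → ℝ≥0∞}, Measurable G →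
      MeasurableSet {p : X × ℝ | ENNReal.ofReal p.2 < G p.1} := fun hG =>
    measurableSet_lt (ENNReal.measurable_ofReal.comp measurable_snd) (hG.comp measurable_fst)
  have hJ1 : Measurable fun p : X × ℝ =>
      {t : ℝ | ENNReal.ofReal t < M p.1}.indicator (fun t => ENNReal.ofReal t ^ (r - 1)) p.2 :=
    ((hpow (r - 1)).comp measurable_snd).indicator (hind hMmeas)
  have h2g : Measurable fun x => 2 * g x := hg.const_mul 2
  have hJ2 : Measurable fun p : X × ℝ => g p.1 *
      {t : ℝ | ENNReal.ofReal t < 2 * g p.1}.indicator (fun t => ENNReal.ofReal t ^ (r - 2)) p.2 :=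
    (hg.comp measurable_fst).mul (((hpow (r - 2)).comp measurable_snd).indicator (hind h2g))
  have hlevel : ∀ t : ℝ, 0 < t →
      ∫⁻ x, {t : ℝ | ENNReal.ofReal t < M x}.indicator (fun t => ENNReal.ofReal t ^ (r - 1)) t ∂μ ≤
      (A : ℝ≥0∞) ^ 3 * 2 * ∫⁻ x, g x * {t : ℝ | ENNReal.ofReal t < 2 * g x}.indicator
        (fun t => ENNReal.ofReal t ^ (r - 2)) t ∂μ := by
    intro t ht
    have hT0 : ENNReal.ofReal t ≠ 0 := by simpa using ht
    have hT1 : ENNReal.ofReal t ≠ ∞ := ENNReal.ofReal_ne_top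
    set T := ENNReal.ofReal t
    calc _ = ∫⁻ x, {x | T < M x}.indicator (fun _ => T ^ (r - 1)) x ∂μ := by
            simp only [indicator_apply, mem_ofPred_eq]; rfl
      _ = T ^ (r - 1) * μ {x | T < M x} :=
          lintegral_indicator_const (measurableSet_lt measurable_const hMmeas) _
      _ ≤ T ^ (r - 1) * (A ^ 3 / (T / 2) * ∫⁻ x, {x | T < 2 * g x}.indicator g x ∂μ) := by
          gcongr
          exact h.measure_lt_uncenteredMax_le_truncation hA g hT0 hT1
      _ = A ^ 3 * 2 * (T ^ (r - 2) * ∫⁻ x, {x | T < 2 * g x}.indicator g x ∂μ) := by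
          have : T ^ (r - 1) = T ^ (r - 2) * T := by
            conv_rhs => rw [← ENNReal.rpow_one T, ← ENNReal.rpow_mul, one_mul,
              ← ENNReal.rpow_add _ _ hT0 hT1]
            ring_nf
          rw [this, div_eq_mul_inv, ENNReal.inv_div (by simp) (by simp), div_eq_mul_inv]
          calc _ = (T * T⁻¹) * (A ^ 3 * 2 *
                (T ^ (r - 2) * ∫⁻ x, {x | T < 2 * g x}.indicator g x ∂μ)) := by ring
            _ = _ := by rw [ENNReal.mul_inv_cancel hT0 hT1, one_mul]
      _ = _ := by
          rw [← lintegral_const_mul _ (hg.indicator (measurableSet_lt measurable_const h2g))]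
          congr 2 with x
          simp only [indicator_apply, mem_ofPred_eq]
          split_ifs
          · exact mul_comm _ _
          · rw [mul_zero, mul_zero]
  calc ∫⁻ x, M x ^ r ∂μ
      ≤ ∫⁻ x, 2 ^ r * (∫⁻ t in Ioi (0 : ℝ), {t : ℝ | ENNReal.ofReal t < M x}.indicator
          (fun t => ENNReal.ofReal t ^ (r - 1)) t) ∂μ :=
        lintegral_mono fun x => ennreal_rpow_le_two_rpow_mul_lintegral (M x) hr.le
    _ = 2 ^ r * ∫⁻ t in Ioi (0 : ℝ), ∫⁻ x, {t : ℝ | ENNReal.ofReal t < M x}.indicator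
          (fun t => ENNReal.ofReal t ^ (r - 1)) t ∂μ := by
        rw [lintegral_const_mul _ hJ1.lintegral_prod_right',
          lintegral_lintegral_swap hJ1.aemeasurable]
    _ ≤ 2 ^ r * ∫⁻ t in Ioi (0 : ℝ), (A : ℝ≥0∞) ^ 3 * 2 * ∫⁻ x, g x *
          {t : ℝ | ENNReal.ofReal t < 2 * g x}.indicator
            (fun t => ENNReal.ofReal t ^ (r - 2)) t ∂μ := by
        gcongr 2 ^ r * ?_
        exact setLIntegral_mono' measurableSet_Ioi hlevel
    _ = 2 ^ r * (A ^ 3 * 2 * ∫⁻ x, g x * (∫⁻ t in Ioi (0 : ℝ),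
          {t : ℝ | ENNReal.ofReal t < 2 * g x}.indicator
            (fun t => ENNReal.ofReal t ^ (r - 2)) t) ∂μ) := by
        rw [lintegral_const_mul _ hJ2.lintegral_prod_left',
          ← lintegral_lintegral_swap hJ2.aemeasurable]
        congr 3 with x
        exact lintegral_const_mul (g x) ((hpow (r - 2)).indicator
          (measurableSet_lt ENNReal.measurable_ofReal (@measurable_const _ _ _ _ (2 * g x))))
    _ ≤ 2 ^ r * (A ^ 3 * 2 * ∫⁻ x,
          ENNReal.ofReal (1 / (r - 1)) * 2 ^ (r - 1) * g x ^ r ∂μ) := by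
        gcongr 2 ^ r * (_ * ?_)
        refine lintegral_mono fun x => ?_
        calc _ ≤ g x * (ENNReal.ofReal (1 / (r - 1)) * (2 * g x) ^ (r - 1)) := by
              gcongr
              exact lintegral_indicator_ofReal_rpow_le _ hr
          _ = ENNReal.ofReal (1 / (r - 1)) * 2 ^ (r - 1) * (g x ^ (r - 1) * g x) := by
              rw [ENNReal.mul_rpow_of_nonneg _ _ hr1.le]
              ring
          _ = _ := by
              have : g x ^ r = g x ^ (r - 1) * g x := by
                conv_lhs => rw [← sub_add_cancel r 1,
                  ENNReal.rpow_add_of_nonneg _ _ hr1.le one_pos.le, ENNReal.rpow_one]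
              rw [this]
    _ = _ := by
        rw [lintegral_const_mul _ (hg.pow_const r), strongTypeConst]
        ring

theorem inv_le_const_mul_inv {a b : ℝ≥0∞} (hA : 1 ≤ A) {n : ℕ} (hab : a ≤ (A : ℝ≥0∞) ^ n * b) :
    b⁻¹ ≤ (A : ℝ≥0∞) ^ n * a⁻¹ := by
  have hA0 : (A : ℝ≥0∞) ^ n ≠ 0 := pow_ne_zero _ (by
    exact_mod_cast (zero_lt_one.trans_le hA).ne')
  have hA1 : (A : ℝ≥0∞) ^ n ≠ ∞ := ENNReal.pow_ne_top ENNReal.coe_ne_top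
  rw [← div_eq_mul_inv, ← ENNReal.inv_div (Or.inl hA1) (Or.inl hA0), ENNReal.inv_le_inv]
  exact ENNReal.div_le_of_le_mul' hab

/-- A consequence of the Lebesgue differentiation theorem. -/
theorem ae_le_mul_uncenteredMax (h : GloballyDoubling μ A) (hA : 1 ≤ A) {g : X → ℝ≥0∞}
    (hg : Measurable g) (hfin : ∫⁻ x, g x ∂μ ≠ ∞) :
    ∀ᵐ x ∂μ, g x ≤ A * uncenteredMax μ g x := by
  have := h.isUnifLocDoublingMeasure
  have := h.isLocallyFiniteMeasure
  filter_upwards [(IsUnifLocDoublingMeasure.vitaliFamily μ 1).ae_tendsto_lintegral_div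
    hg.aemeasurable hfin] with x hx
  have hlim := hx.comp (IsUnifLocDoublingMeasure.tendsto_closedBall_filterAt μ (K := 1)
    (l := 𝓝[>] (0 : ℝ)) (x := x) (fun _ => x) id tendsto_id (by
      filter_upwards [self_mem_nhdsWithin] with ε (hε : 0 < ε)
      exact mem_closedBall_self (by simpa using hε.le)))
  refine le_of_tendsto hlim ?_
  filter_upwards [self_mem_nhdsWithin] with ε (hε : 0 < ε)
  calc (∫⁻ y in closedBall x ε, g y ∂μ) / μ (closedBall x ε)
      ≤ (∫⁻ y in ball x (2 * ε), g y ∂μ) / μ (ball x ε) := by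
        refine ENNReal.div_le_div (lintegral_mono_set (closedBall_subset_ball (by linarith)))
          (measure_mono ball_subset_closedBall)
    _ = (μ (ball x ε))⁻¹ * ∫⁻ y in ball x (2 * ε), g y ∂μ := by
        rw [div_eq_mul_inv, mul_comm]
    _ ≤ A ^ 1 * (μ (ball x (2 * ε)))⁻¹ * ∫⁻ y in ball x (2 * ε), g y ∂μ := by
        gcongr
        exact inv_le_const_mul_inv hA (by simpa using h.doubling x ε hε)
    _ ≤ A * uncenteredMax μ g x := by
        rw [pow_one, mul_assoc]
        gcongr
        exact le_uncenteredMax μ g (mem_ball_self (by positivity))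

omit [BorelSpace X] in
/-- A Whitney type covering of an open set of finite measure. -/
theorem exists_whitney_covering (h : GloballyDoubling μ A) {Ω : Set X} (hΩ : IsOpen Ω)
    (hfin : μ Ω ≠ ∞) (hne : Ωᶜ.Nonempty) :
    ∃ u ⊆ Ω, u.Countable ∧
      (u.PairwiseDisjoint fun p => closedBall p (infDist p Ωᶜ / 10)) ∧
      Ω ⊆ ⋃ p ∈ u, closedBall p (infDist p Ωᶜ / 2) := by
  have hpos : ∀ p ∈ Ω, 0 < infDist p Ωᶜ := fun p hp =>
    (hΩ.isClosed_compl.notMem_iff_infDist_pos hne).1 (by simpa using hp)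
  obtain ⟨R, hR⟩ := h.growth (μ Ω) (lt_top_iff_ne_top.2 hfin)
  have hbound : ∀ p ∈ Ω, infDist p Ωᶜ / 10 ≤ R / 10 := by
    intro p hp
    by_contra! hlt
    exact (hR p (infDist p Ωᶜ) (by linarith)).not_ge (measure_mono ball_infDist_compl_subset)
  obtain ⟨u, huΩ, hdisj, hcov⟩ := Vitali.exists_disjoint_subfamily_covering_enlargement_closedBall
    Ω id (fun p => infDist p Ωᶜ / 10) (R / 10) hbound 5 (by norm_num)
  refine ⟨u, huΩ, hdisj.countable_of_nonempty_interior fun p hp =>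
    ⟨p, ball_subset_interior_closedBall (mem_ball_self ?_)⟩, hdisj, fun x hx => ?_⟩
  · have := hpos p (huΩ hp)
    positivity
  · obtain ⟨p, hpu, hp⟩ := hcov x hx
    refine mem_iUnion₂.2 ⟨p, hpu, ?_⟩
    have := hp (mem_closedBall_self (by have := hpos x hx; positivity))
    convert! this using 2
    ring

/-- The function which on each Whitney ball `closedBall p (dist (p, Ωᶜ) / 10)`, `p ∈ u`, is the
integral of `g` over the enlarged ball divided by the measure of the ball. -/
def whitneyAverage (μ : Measure X) (Ω u : Set X) (g : X → ℝ≥0∞) (x : X) : ℝ≥0∞ :=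
  ∑' p : u, (closedBall (p : X) (infDist (p : X) Ωᶜ / 10)).indicator
    (fun _ => (μ (closedBall (p : X) (infDist (p : X) Ωᶜ / 10)))⁻¹ *
      ∫⁻ z in closedBall (p : X) (infDist (p : X) Ωᶜ / 2), g z ∂μ) x

omit [SecondCountableTopology X] in
theorem measurable_whitneyAverage {Ω u : Set X} (hu : u.Countable) (g : X → ℝ≥0∞) :
    Measurable (whitneyAverage μ Ω u g) := by
  have := hu.to_subtype
  exact Measurable.tsum fun p => measurable_const.indicator measurableSet_closedBall

omit [BorelSpace X] [SecondCountableTopology X] in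
theorem whitneyAverage_eq {Ω u : Set X} (g : X → ℝ≥0∞)
    (hdisj : u.PairwiseDisjoint fun p => closedBall p (infDist p Ωᶜ / 10)) {p x : X} (hp : p ∈ u)
    (hx : x ∈ closedBall p (infDist p Ωᶜ / 10)) :
    whitneyAverage μ Ω u g x = (μ (closedBall p (infDist p Ωᶜ / 10)))⁻¹ *
      ∫⁻ z in closedBall p (infDist p Ωᶜ / 2), g z ∂μ := by
  rw [whitneyAverage, tsum_eq_single (⟨p, hp⟩ : u), indicator_of_mem hx]
  intro q hq
  refine indicator_of_notMem (fun hxq => ?_) _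
  exact disjoint_left.1 (hdisj q.2 hp fun he => hq (Subtype.ext he)) hxq hx

omit [BorelSpace X] [SecondCountableTopology X] in
theorem whitneyAverage_eq_zero {Ω u : Set X} (g : X → ℝ≥0∞) {x : X}
    (hx : ∀ p ∈ u, x ∉ closedBall p (infDist p Ωᶜ / 10)) : whitneyAverage μ Ω u g x = 0 :=
  ENNReal.tsum_eq_zero.2 fun p => indicator_of_notMem (hx p p.2) _

omit [SecondCountableTopology X] in
/-- Off `Ω`, the maximal function is controlled after averaging over Whitney balls inside `Ω`. -/
theorem uncenteredMax_le_whitney (h : GloballyDoubling μ A) (hA : 1 ≤ A) {Ω u : Set X}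
    (hΩ : IsOpen Ω) (hne : Ωᶜ.Nonempty) (huΩ : u ⊆ Ω) (hu : u.Countable)
    (hdisj : u.PairwiseDisjoint fun p => closedBall p (infDist p Ωᶜ / 10))
    (hcov : Ω ⊆ ⋃ p ∈ u, closedBall p (infDist p Ωᶜ / 2))
    {g : X → ℝ≥0∞} (hg : Measurable g) {x : X} (hx : x ∉ Ω) :
    uncenteredMax μ g x ≤
      A ^ 2 * uncenteredMax μ (fun z => Ωᶜ.indicator g z + whitneyAverage μ Ω u g z) x := by
  set k : X → ℝ≥0∞ := fun z => Ωᶜ.indicator g z + whitneyAverage μ Ω u g z with hk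
  refine uncenteredMax_le_iff.2 fun y s hxs => ?_
  have hs : 0 < s := pos_of_mem_ball hxs
  have hpos : ∀ p ∈ u, 0 < infDist p Ωᶜ := fun p hp =>
    (hΩ.isClosed_compl.notMem_iff_infDist_pos hne).1 (by simpa using huΩ hp)
  set v : Set X := {p ∈ u | (closedBall p (infDist p Ωᶜ / 2) ∩ ball y s).Nonempty} with hv
  have hvu : v ⊆ u := fun p hp => hp.1
  have hvc : v.Countable := hu.mono hvu
  have := hvc.to_subtype
  have hsub : ball y s ⊆ (Ωᶜ ∩ ball y s) ∪ ⋃ p : v, closedBall p.1 (infDist p.1 Ωᶜ / 2) := by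
    intro z hz
    by_cases hzΩ : z ∈ Ω
    · obtain ⟨p, hpu, hp⟩ := mem_iUnion₂.1 (hcov hzΩ)
      exact Or.inr (mem_iUnion.2 ⟨⟨p, hpu, z, hp, hz⟩, hp⟩)
    · exact Or.inl ⟨hzΩ, hz⟩
  have hball : ∀ p ∈ v, closedBall p (infDist p Ωᶜ / 10) ⊆ ball y (2 ^ 2 * s) := by
    rintro p ⟨hpu, w, hw, hwy⟩ q hq
    rw [mem_closedBall] at hw hq
    rw [mem_ball] at hwy hxs ⊢
    have h1 : infDist p Ωᶜ ≤ dist p x := infDist_le_dist_of_mem hx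
    have h2 : dist p x ≤ dist w p + dist w y + dist x y := by
      rw [dist_comm w p, dist_comm x y]
      exact dist_triangle4 p w y x
    have h3 : dist q y ≤ dist q p + dist w p + dist w y := by
      rw [dist_comm w p]
      exact dist_triangle4 q p w y
    linarith
  have hint : ∫⁻ z in ball y s, g z ∂μ ≤ ∫⁻ z in ball y (2 ^ 2 * s), k z ∂μ := by
    calc ∫⁻ z in ball y s, g z ∂μ
        ≤ ∫⁻ z in Ωᶜ ∩ ball y s, g z ∂μ +
            ∑' p : v, ∫⁻ z in closedBall p.1 (infDist p.1 Ωᶜ / 2), g z ∂μ :=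
          (lintegral_mono_set hsub).trans <| (lintegral_union_le _ _ _).trans <| by
            gcongr
            exact lintegral_iUnion_le _ _
      _ ≤ ∫⁻ z in ball y (2 ^ 2 * s), Ωᶜ.indicator g z ∂μ +
            ∑' p : v, ∫⁻ z in closedBall p.1 (infDist p.1 Ωᶜ / 10),
              whitneyAverage μ Ω u g z ∂μ := by
          refine add_le_add ?_ (ENNReal.tsum_le_tsum fun p => ?_)
          · rw [lintegral_indicator hΩ.measurableSet.compl,
              Measure.restrict_restrict hΩ.measurableSet.compl]
            exact lintegral_mono_set (inter_subset_inter_right _ (ball_subset_ball (by linarith)))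
          · have hp := hpos p.1 (hvu p.2)
            have hBpos : μ (closedBall p.1 (infDist p.1 Ωᶜ / 10)) ≠ 0 :=
              ((h.pos p.1 (infDist p.1 Ωᶜ / 10) (by positivity)).trans_le
                (measure_mono ball_subset_closedBall)).ne'
            have hBfin : μ (closedBall p.1 (infDist p.1 Ωᶜ / 10)) ≠ ∞ :=
              ((measure_mono (closedBall_subset_ball (by linarith))).trans_lt
                (h.finite p.1 (infDist p.1 Ωᶜ))).ne
            rw [setLIntegral_congr_fun measurableSet_closedBall
              fun z hz => whitneyAverage_eq g hdisj (hvu p.2) hz, setLIntegral_const,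
              mul_right_comm, ENNReal.inv_mul_cancel hBpos hBfin, one_mul]
      _ = ∫⁻ z in ball y (2 ^ 2 * s), Ωᶜ.indicator g z ∂μ +
            ∫⁻ z in ⋃ p ∈ v, closedBall p (infDist p Ωᶜ / 10), whitneyAverage μ Ω u g z ∂μ := by
          rw [lintegral_biUnion hvc (fun _ _ => measurableSet_closedBall) (hdisj.subset hvu)]
      _ ≤ ∫⁻ z in ball y (2 ^ 2 * s), Ωᶜ.indicator g z ∂μ +
            ∫⁻ z in ball y (2 ^ 2 * s), whitneyAverage μ Ω u g z ∂μ := by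
          gcongr
          exact iUnion₂_subset hball
      _ = _ := by
          rw [hk, lintegral_add_left (hg.indicator hΩ.measurableSet.compl)]
  calc (μ (ball y s))⁻¹ * ∫⁻ z in ball y s, g z ∂μ
      ≤ (A ^ 2 * (μ (ball y (2 ^ 2 * s)))⁻¹) * ∫⁻ z in ball y (2 ^ 2 * s), k z ∂μ := by
        gcongr
        exact inv_le_const_mul_inv hA (h.measure_ball_pow_le y hs 2)
    _ ≤ _ := by
        rw [mul_assoc]
        gcongr
        exact le_uncenteredMax μ k (ball_subset_ball (by linarith) hxs)

omit [BorelSpace X] [SecondCountableTopology X] in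
/-- On a Whitney ball of a level set, the averages have controlled `ℓ^r` norm. -/
theorem tsum_whitneyAverage_rpow_le (h : GloballyDoubling μ A) {g : ℕ → X → ℝ≥0∞}
    (hg : ∀ n, Measurable (g n)) {r : ℝ} (hr : 1 < r) {t : ℝ≥0∞} {Ω u : Set X}
    (hΩdef : Ω = {x | t < uncenteredMax μ (fun x => (∑' n, g n x ^ r) ^ (1 / r)) x})
    (hne : Ωᶜ.Nonempty) (huΩ : u ⊆ Ω)
    (hdisj : u.PairwiseDisjoint fun p => closedBall p (infDist p Ωᶜ / 10)) (x : X) :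
    ∑' n, whitneyAverage μ Ω u (g n) x ^ r ≤ (A ^ 5 * t) ^ r := by
  have hr0 : 0 < r := by linarith
  set F : X → ℝ≥0∞ := fun x => (∑' n, g n x ^ r) ^ (1 / r) with hF
  have hΩ : IsOpen Ω := hΩdef ▸ isOpen_lt_uncenteredMax μ F t
  by_cases hx : ∀ p ∈ u, x ∉ closedBall p (infDist p Ωᶜ / 10)
  · simp [whitneyAverage_eq_zero _ hx, hr0]
  push Not at hx
  obtain ⟨p, hp, hxp⟩ := hx
  have hpos : 0 < infDist p Ωᶜ :=
    (hΩ.isClosed_compl.notMem_iff_infDist_pos hne).1 (by simpa using huΩ hp)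
  set δ := infDist p Ωᶜ with hδ
  have hBpos : μ (closedBall p (δ / 10)) ≠ 0 :=
    ((h.pos p (δ / 10) (by positivity)).trans_le (measure_mono ball_subset_closedBall)).ne'
  have hBfin : μ (closedBall p (δ / 10)) ≠ ∞ :=
    ((measure_mono (closedBall_subset_ball (by linarith))).trans_lt (h.finite p δ)).ne
  obtain ⟨z, hz, hzp⟩ := (infDist_lt_iff hne).1 (show infDist p Ωᶜ < 2 * δ by linarith)
  have hzM : uncenteredMax μ F z ≤ t := by
    rw [hΩdef] at hz
    exact not_lt.1 hz
  have hFint : ∫⁻ z in closedBall p (δ / 2), F z ∂μ ≤ A ^ 5 * t * μ (closedBall p (δ / 10)) := by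
    have h1 : (μ (ball p (2 * δ)))⁻¹ * ∫⁻ z in ball p (2 * δ), F z ∂μ ≤ t :=
      (le_uncenteredMax μ F (mem_ball'.2 hzp)).trans hzM
    rw [mul_comm, ← div_eq_mul_inv, ENNReal.div_le_iff (h.pos p _ (by positivity)).ne'
      (h.finite p _).ne] at h1
    calc ∫⁻ z in closedBall p (δ / 2), F z ∂μ ≤ ∫⁻ z in ball p (2 * δ), F z ∂μ :=
          lintegral_mono_set (closedBall_subset_ball (by linarith))
      _ ≤ t * μ (ball p (2 ^ 5 * (δ / 16))) := by
          convert! h1 using 4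
          ring
      _ ≤ t * (A ^ 5 * μ (ball p (δ / 16))) := by
          gcongr
          exact h.measure_ball_pow_le p (by positivity) 5
      _ ≤ t * (A ^ 5 * μ (closedBall p (δ / 10))) := by
          gcongr
          exact ball_subset_closedBall.trans (closedBall_subset_closedBall (by linarith))
      _ = _ := by ring
  calc ∑' n, whitneyAverage μ Ω u (g n) x ^ r
      = ((μ (closedBall p (δ / 10)))⁻¹) ^ r *
          ∑' n, (∫⁻ z in closedBall p (δ / 2), g n z ∂μ) ^ r := by
        rw [← ENNReal.tsum_mul_left]
        congr 1 with n
        rw [whitneyAverage_eq (g n) hdisj hp hxp, ENNReal.mul_rpow_of_nonneg _ _ hr0.le]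
    _ ≤ ((μ (closedBall p (δ / 10)))⁻¹) ^ r * (∫⁻ z in closedBall p (δ / 2), F z ∂μ) ^ r := by
        gcongr
        exact tsum_lintegral_rpow_le hg hr
    _ = ((μ (closedBall p (δ / 10)))⁻¹ * ∫⁻ z in closedBall p (δ / 2), F z ∂μ) ^ r :=
        (ENNReal.mul_rpow_of_nonneg _ _ hr0.le).symm
    _ ≤ _ := by
        refine ENNReal.rpow_le_rpow ?_ hr0.le
        rw [mul_comm, ← div_eq_mul_inv]
        exact (ENNReal.div_le_iff hBpos hBfin).2 hFint

/-- The constant in the vector-valued weak type `(1,1)` inequality. -/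
def weakTypeConst (A : ℝ≥0) (r : ℝ) : ℝ≥0∞ :=
  A ^ 3 + (A ^ 2) ^ r * strongTypeConst A r * ((A ^ 5) ^ (r - 1) * (1 + A ^ 8))

omit [BorelSpace X] [SecondCountableTopology X] in
theorem weakTypeConst_ne_top {A : ℝ≥0} {r : ℝ} (hr : 1 < r) : weakTypeConst A r ≠ ∞ := by
  have hpow : ∀ n : ℕ, (A : ℝ≥0∞) ^ n ≠ ∞ := fun n => ENNReal.pow_ne_top ENNReal.coe_ne_top
  unfold weakTypeConst
  refine ENNReal.add_ne_top.2 ⟨hpow 3, ENNReal.mul_ne_top (ENNReal.mul_ne_top ?_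
    (strongTypeConst_ne_top A r)) (ENNReal.mul_ne_top ?_ (ENNReal.add_ne_top.2 ⟨by simp, hpow 8⟩))⟩
  · exact ENNReal.rpow_ne_top_of_nonneg (by linarith) (hpow 2)
  · exact ENNReal.rpow_ne_top_of_nonneg (by linarith) (hpow 5)

/-- The Fefferman–Stein vector-valued weak type `(1,1)` inequality. -/
theorem measure_lt_tsum_uncenteredMax_le (h : GloballyDoubling μ A) (hA : 1 ≤ A)
    {g : ℕ → X → ℝ≥0∞} (hg : ∀ n, Measurable (g n)) {r : ℝ} (hr : 1 < r)
    (hfin : ∫⁻ x, (∑' n, g n x ^ r) ^ (1 / r) ∂μ ≠ ∞) {t : ℝ≥0∞} (ht : t ≠ 0) (ht' : t ≠ ∞) :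
    μ {x | t < (∑' n, uncenteredMax μ (g n) x ^ r) ^ (1 / r)} ≤
      weakTypeConst A r / t * ∫⁻ x, (∑' n, g n x ^ r) ^ (1 / r) ∂μ := by
  have hr0 : 0 < r := by linarith
  have hr1 : 0 < r - 1 := by linarith
  set F : X → ℝ≥0∞ := fun x => (∑' n, g n x ^ r) ^ (1 / r) with hF
  have hFmeas : Measurable F := (Measurable.tsum fun n => (hg n).pow_const r).pow_const _
  have hFr : ∀ x, ∑' n, g n x ^ r = F x ^ r := fun x => by
    rw [hF, ← ENNReal.rpow_mul, one_div, inv_mul_cancel₀ hr0.ne', ENNReal.rpow_one]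
  set Ω := {x | t < uncenteredMax μ F x} with hΩdef
  have hΩ : IsOpen Ω := isOpen_lt_uncenteredMax μ F t
  have hΩle : μ Ω ≤ A ^ 3 / t * ∫⁻ x, F x ∂μ := h.measure_lt_uncenteredMax_le hA F ht ht'
  have hΩfin : μ Ω ≠ ∞ := ne_top_of_le_ne_top (ENNReal.mul_ne_top
    (ENNReal.div_ne_top (ENNReal.pow_ne_top ENNReal.coe_ne_top) ht) hfin) hΩle
  rcases eq_empty_or_nonempty Ωᶜ with hemp | hne
  · have huniv : Ω = univ := by simpa using hemp
    calc _ ≤ μ Ω := measure_mono (by rw [huniv]; exact subset_univ _)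
      _ ≤ A ^ 3 / t * ∫⁻ x, F x ∂μ := hΩle
      _ ≤ _ := by
        gcongr
        exact le_self_add
  obtain ⟨u, huΩ, hu, hdisj, hcov⟩ := h.exists_whitney_covering hΩ hΩfin hne
  have hsubΩ : ∀ p ∈ u, closedBall p (infDist p Ωᶜ / 10) ⊆ Ω := fun p hp => by
    have := (hΩ.isClosed_compl.notMem_iff_infDist_pos hne).1 (by simpa using huΩ hp)
    exact (closedBall_subset_ball (by linarith)).trans ball_infDist_compl_subset
  set k : ℕ → X → ℝ≥0∞ := fun n z => Ωᶜ.indicator (g n) z + whitneyAverage μ Ω u (g n) z with hk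
  have hkmeas : ∀ n, Measurable (k n) := fun n =>
    ((hg n).indicator hΩ.measurableSet.compl).add (measurable_whitneyAverage hu (g n))
  set T : ℝ≥0∞ := A ^ 5 * t with hT
  have hA1 : (1 : ℝ≥0∞) ≤ A := by exact_mod_cast hA
  have hkle : ∀ᵐ x ∂μ, ∑' n, k n x ^ r ≤ T ^ (r - 1) * F x + Ω.indicator (fun _ => T ^ r) x := by
    filter_upwards [h.ae_le_mul_uncenteredMax hA hFmeas hfin] with x hx
    by_cases hxΩ : x ∈ Ω
    · rw [indicator_of_mem hxΩ]
      refine le_add_left ?_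
      simp only [hk, indicator_of_notMem (show x ∉ Ωᶜ from fun hc => hc hxΩ), zero_add]
      exact h.tsum_whitneyAverage_rpow_le hg hr hΩdef hne huΩ hdisj x
    · rw [indicator_of_notMem hxΩ, add_zero]
      simp only [hk, indicator_of_mem (show x ∈ Ωᶜ from hxΩ),
        whitneyAverage_eq_zero _ (fun p hp hxp => hxΩ (hsubΩ p hp hxp)), add_zero]
      have hFT : F x ≤ T := by
        refine hx.trans ?_
        have h1 : (A : ℝ≥0∞) ≤ A ^ 5 := le_self_pow₀ hA1 (by norm_num)
        exact mul_le_mul' h1 (not_lt.1 hxΩ)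
      have : F x ^ r = F x ^ (r - 1) * F x := by
        conv_lhs => rw [← sub_add_cancel r 1,
          ENNReal.rpow_add_of_nonneg _ _ hr1.le one_pos.le, ENNReal.rpow_one]
      rw [hFr, this]
      gcongr
  have hTr : T ^ r = T ^ (r - 1) * T := by
    conv_lhs => rw [← sub_add_cancel r 1,
      ENNReal.rpow_add_of_nonneg _ _ hr1.le one_pos.le, ENNReal.rpow_one]
  have hkint : ∫⁻ x, ∑' n, k n x ^ r ∂μ ≤ T ^ (r - 1) * (1 + A ^ 8) * ∫⁻ x, F x ∂μ := by
    calc ∫⁻ x, ∑' n, k n x ^ r ∂μ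
        ≤ ∫⁻ x, (T ^ (r - 1) * F x + Ω.indicator (fun _ => T ^ r) x) ∂μ := lintegral_mono_ae hkle
      _ = T ^ (r - 1) * ∫⁻ x, F x ∂μ + T ^ r * μ Ω := by
          rw [lintegral_add_left (hFmeas.const_mul _), lintegral_const_mul _ hFmeas,
            lintegral_indicator_const hΩ.measurableSet]
      _ ≤ T ^ (r - 1) * ∫⁻ x, F x ∂μ + T ^ r * (A ^ 3 / t * ∫⁻ x, F x ∂μ) := by gcongr
      _ = T ^ (r - 1) * ∫⁻ x, F x ∂μ +
            T ^ (r - 1) * (A ^ 8 * (t * t⁻¹) * ∫⁻ x, F x ∂μ) := by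
          rw [hTr, hT, div_eq_mul_inv]
          ring
      _ = _ := by
          rw [ENNReal.mul_inv_cancel ht ht']
          ring
  set H : X → ℝ≥0∞ := fun x => ∑' n, uncenteredMax μ (k n) x ^ r with hH
  have hHmeas : ∀ n, Measurable fun x => uncenteredMax μ (k n) x ^ r := fun n =>
    (measurable_uncenteredMax μ (k n)).pow_const r
  have hHint : ∫⁻ x, H x ∂μ ≤
      strongTypeConst A r * (T ^ (r - 1) * (1 + A ^ 8) * ∫⁻ x, F x ∂μ) := by
    calc ∫⁻ x, H x ∂μ = ∑' n, ∫⁻ x, uncenteredMax μ (k n) x ^ r ∂μ :=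
          lintegral_tsum fun n => (hHmeas n).aemeasurable
      _ ≤ ∑' n, strongTypeConst A r * ∫⁻ x, k n x ^ r ∂μ :=
          ENNReal.tsum_le_tsum fun n => h.lintegral_rpow_uncenteredMax_le hA (hkmeas n) hr
      _ = strongTypeConst A r * ∫⁻ x, ∑' n, k n x ^ r ∂μ := by
          rw [ENNReal.tsum_mul_left, lintegral_tsum fun n => ((hkmeas n).pow_const r).aemeasurable]
      _ ≤ _ := by gcongr
  have htr0 : t ^ r ≠ 0 := (ENNReal.rpow_pos (pos_iff_ne_zero.2 ht) ht').ne'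
  have htr' : t ^ r ≠ ∞ := ENNReal.rpow_ne_top_of_nonneg hr0.le ht'
  have hsub : {x | t < (∑' n, uncenteredMax μ (g n) x ^ r) ^ (1 / r)} ⊆
      Ω ∪ {x | t ^ r ≤ (A ^ 2) ^ r * H x} := by
    intro x hx
    by_cases hxΩ : x ∈ Ω
    · exact Or.inl hxΩ
    refine Or.inr ?_
    have hx : t < (∑' n, uncenteredMax μ (g n) x ^ r) ^ (1 / r) := hx
    rw [one_div, ENNReal.lt_rpow_inv_iff hr0] at hx
    refine hx.le.trans ?_
    rw [hH, ← ENNReal.tsum_mul_left]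
    refine ENNReal.tsum_le_tsum fun n => ?_
    rw [← ENNReal.mul_rpow_of_nonneg _ _ hr0.le]
    exact ENNReal.rpow_le_rpow
      (h.uncenteredMax_le_whitney hA hΩ hne huΩ hu hdisj hcov (hg n) hxΩ) hr0.le
  calc _ ≤ μ Ω + μ {x | t ^ r ≤ (A ^ 2) ^ r * H x} :=
        (measure_mono hsub).trans (measure_union_le _ _)
    _ ≤ A ^ 3 / t * ∫⁻ x, F x ∂μ + (∫⁻ x, (A ^ 2) ^ r * H x ∂μ) / t ^ r := by
        gcongr
        exact meas_ge_le_lintegral_div ((Measurable.tsum hHmeas).const_mul _).aemeasurable htr0 htr'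
    _ ≤ A ^ 3 / t * ∫⁻ x, F x ∂μ + ((A ^ 2) ^ r *
          (strongTypeConst A r * (T ^ (r - 1) * (1 + A ^ 8) * ∫⁻ x, F x ∂μ))) / t ^ r := by
        rw [lintegral_const_mul _ (Measurable.tsum hHmeas)]
        gcongr
    _ = weakTypeConst A r / t * ∫⁻ x, F x ∂μ := by
        have h1 : T ^ (r - 1) / t ^ r = (A ^ 5) ^ (r - 1) * t⁻¹ := by
          rw [hT, ENNReal.mul_rpow_of_nonneg _ _ hr1.le, mul_div_assoc,
            ← ENNReal.rpow_sub _ _ ht ht',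
            ← ENNReal.rpow_neg_one]
          ring_nf
        calc _ = A ^ 3 / t * ∫⁻ x, F x ∂μ + (A ^ 2) ^ r * strongTypeConst A r *
              (T ^ (r - 1) / t ^ r) * (1 + A ^ 8) * ∫⁻ x, F x ∂μ := by
              simp only [div_eq_mul_inv]
              ring
          _ = _ := by
              rw [h1, weakTypeConst]
              simp only [div_eq_mul_inv]
              ring

end GloballyDoubling

end Doubling

/-! ### The power weight and sign changes -/

section PowerWeight

open Metric

variable {d : ℕ} {κ : Fin d → ℝ}

theorem measurable_prod_abs_rpow (κ : Fin d → ℝ) :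
    Measurable fun x : Fin d → ℝ => ENNReal.ofReal (∏ j, |x j| ^ (2 * κ j)) := by
  fun_prop

theorem muK_closedBall_le (hκ : ∀ j, 0 ≤ κ j) (x : Fin d → ℝ) {s : ℝ} (hs : 0 ≤ s) :
    muK d κ (closedBall x s) ≤ ENNReal.ofReal (∏ j, 2 * s * (|x j| + s) ^ (2 * κ j)) := by
  rw [muK, withDensity_apply _ measurableSet_closedBall]
  calc ∫⁻ y in closedBall x s, ENNReal.ofReal (∏ j, |y j| ^ (2 * κ j))
      ≤ ∫⁻ _ in closedBall x s, ENNReal.ofReal (∏ j, (|x j| + s) ^ (2 * κ j)) := by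
        refine setLIntegral_mono measurable_const fun y hy => ENNReal.ofReal_le_ofReal ?_
        refine Finset.prod_le_prod (fun j _ => by positivity) fun j _ => ?_
        refine rpow_le_rpow (abs_nonneg _) ?_ (by have := hκ j; positivity)
        have h1 : |y j - x j| ≤ s := (dist_le_pi_dist y x j).trans hy
        have h2 := abs_sub_abs_le_abs_sub (y j) (x j)
        linarith
    _ = ENNReal.ofReal (∏ j, 2 * s * (|x j| + s) ^ (2 * κ j)) := by
        rw [setLIntegral_const, Real.volume_pi_closedBall _ hs,
          ← ENNReal.ofReal_mul (by positivity),
          Finset.prod_mul_distrib, Finset.prod_const, Finset.card_univ, mul_comm]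

theorem le_muK_Icc (hκ : ∀ j, 0 ≤ κ j) {a b c : Fin d → ℝ} (hab : a ≤ b) (hc : 0 ≤ c)
    (h : ∀ j, ∀ t ∈ Icc (a j) (b j), c j ≤ |t|) :
    ENNReal.ofReal (∏ j, (b j - a j) * c j ^ (2 * κ j)) ≤ muK d κ (Icc a b) := by
  rw [muK, withDensity_apply _ measurableSet_Icc]
  calc ENNReal.ofReal (∏ j, (b j - a j) * c j ^ (2 * κ j))
      = ∫⁻ _ in Icc a b, ENNReal.ofReal (∏ j, c j ^ (2 * κ j)) := by
        rw [setLIntegral_const, Real.volume_Icc_pi,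
          ← ENNReal.ofReal_prod_of_nonneg fun j _ => sub_nonneg.2 (hab j), Finset.prod_mul_distrib,
          mul_comm, ENNReal.ofReal_mul (Finset.prod_nonneg fun j _ => rpow_nonneg (hc j) _)]
    _ ≤ ∫⁻ y in Icc a b, ENNReal.ofReal (∏ j, |y j| ^ (2 * κ j)) := by
        refine setLIntegral_mono (measurable_prod_abs_rpow κ) fun y hy =>
          ENNReal.ofReal_le_ofReal ?_
        refine Finset.prod_le_prod (fun j _ => rpow_nonneg (hc j) _) fun j _ => ?_
        exact rpow_le_rpow (hc j) (h j _ ⟨hy.1 j, hy.2 j⟩) (by have := hκ j; positivity)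

theorem le_muK_ball (hκ : ∀ j, 0 ≤ κ j) (x : Fin d → ℝ) {s : ℝ} (hs : 0 < s) :
    ENNReal.ofReal (∏ j, s / 4 * (|x j| + s / 4) ^ (2 * κ j)) ≤ muK d κ (ball x s) := by
  set a : Fin d → ℝ := fun j => if 0 ≤ x j then x j + s / 4 else x j - s / 2 with ha
  have hmem : ∀ j, ∀ t ∈ Icc (a j) (a j + s / 4), |x j| + s / 4 ≤ |t| ∧ |t - x j| < s := by
    rintro j t ⟨h1, h2⟩
    simp only [ha] at h1 h2
    split_ifs at h1 h2 with hx
    · rw [abs_of_nonneg hx, abs_of_nonneg (by linarith : 0 ≤ t), abs_lt]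
      constructor <;> [linarith; constructor <;> linarith]
    · rw [abs_of_neg (not_le.1 hx), abs_of_nonpos (by linarith : t ≤ 0), abs_lt]
      constructor <;> [linarith; constructor <;> linarith]
  have := le_muK_Icc hκ (a := a) (b := fun j => a j + s / 4) (c := fun j => |x j| + s / 4)
    (fun j => by simp only; linarith) (fun j => by simp only [Pi.zero_apply]; positivity)
    fun j t ht => (hmem j t ht).1
  simp only [add_sub_cancel_left] at this
  refine this.trans (measure_mono fun y hy => ?_)
  exact (dist_pi_lt_iff hs).2 fun j => (hmem j (y j) ⟨hy.1 j, hy.2 j⟩).2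

theorem le_muK_Rset (hκ : ∀ j, 0 ≤ κ j) (x : Fin d → ℝ) {s : ℝ} (hs : 0 < s) :
    ENNReal.ofReal (∏ j, s / 4 * (|x j| + s / 4) ^ (2 * κ j)) ≤ muK d κ (Rset d x s) := by
  have := le_muK_Icc hκ (a := fun j => |x j| + s / 4) (b := fun j => |x j| + s / 4 + s / 4)
    (c := fun j => |x j| + s / 4) (fun j => by simp only; linarith)
    (fun j => by simp only [Pi.zero_apply]; positivity) fun j t ht => ht.1.trans (le_abs_self t)
  simp only [add_sub_cancel_left] at this
  refine this.trans (measure_mono fun y hy j _ => ?_)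
  have h0 := abs_nonneg (x j)
  have h1 : |x j| + s / 4 ≤ y j := hy.1 j
  have h2 : y j ≤ |x j| + s / 4 + s / 4 := hy.2 j
  exact ⟨max_le (by linarith) (by linarith), by linarith⟩

/-- A doubling constant for `muK d κ`. -/
def powerDoublingConst (κ : Fin d → ℝ) : ℝ≥0 := ∏ j, 16 * 8 ^ (2 * κ j)

theorem muK_closedBall_two_mul_le (hκ : ∀ j, 0 ≤ κ j) (x : Fin d → ℝ) {s : ℝ} (hs : 0 < s) :
    muK d κ (closedBall x (2 * s)) ≤ powerDoublingConst κ *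
      ENNReal.ofReal (∏ j, s / 4 * (|x j| + s / 4) ^ (2 * κ j)) := by
  refine (muK_closedBall_le hκ x (by positivity)).trans ?_
  rw [← ENNReal.ofReal_coe_nnreal, ← ENNReal.ofReal_mul (NNReal.coe_nonneg _)]
  refine ENNReal.ofReal_le_ofReal ?_
  rw [powerDoublingConst, NNReal.coe_prod, ← Finset.prod_mul_distrib]
  refine Finset.prod_le_prod (fun j _ => by positivity) fun j _ => ?_
  have hκj := hκ j
  have h1 : (|x j| + 2 * s) ^ (2 * κ j) ≤ (8 * (|x j| + s / 4)) ^ (2 * κ j) :=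
    rpow_le_rpow (by positivity) (by linarith [abs_nonneg (x j)]) (by positivity)
  rw [mul_rpow (by norm_num) (by positivity)] at h1
  push_cast
  calc 2 * (2 * s) * (|x j| + 2 * s) ^ (2 * κ j)
      ≤ 2 * (2 * s) * (8 ^ (2 * κ j) * (|x j| + s / 4) ^ (2 * κ j)) := by gcongr
    _ = _ := by ring

theorem globallyDoubling_muK (hd : 1 ≤ d) (hκ : ∀ j, 0 ≤ κ j) :
    GloballyDoubling (muK d κ) (powerDoublingConst κ) where
  doubling x s hs := (measure_mono ball_subset_closedBall).trans <|
    (muK_closedBall_two_mul_le hκ x hs).trans <| by gcongr; exact le_muK_ball hκ x hs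
  pos x s hs := (ENNReal.ofReal_pos.2 (Finset.prod_pos fun j _ => by positivity)).trans_le
    (le_muK_ball hκ x hs)
  finite x s := by
    rcases le_or_gt s 0 with hs | hs
    · simp [ball_eq_empty.2 hs]
    · exact (measure_mono ball_subset_closedBall).trans_lt
        ((muK_closedBall_le hκ x hs.le).trans_lt ENNReal.ofReal_lt_top)
  growth K hK := by
    refine ⟨max 4 (4 * K.toReal), fun x s hs => ?_⟩
    obtain ⟨hs4, hsK⟩ := max_lt_iff.1 hs
    refine lt_of_lt_of_le ?_ (le_muK_ball hκ x (by linarith))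
    rw [ENNReal.lt_ofReal_iff_toReal_lt hK.ne]
    calc K.toReal < s / 4 := by linarith
      _ ≤ (s / 4) ^ d := le_self_pow₀ (by linarith) (by omega)
      _ = ∏ _j : Fin d, s / 4 := by
        rw [Finset.prod_const, Finset.card_univ, Fintype.card_fin]
      _ ≤ ∏ j, s / 4 * (|x j| + s / 4) ^ (2 * κ j) := by
        refine Finset.prod_le_prod (fun j _ => by positivity) fun j _ => ?_
        refine le_mul_of_one_le_right (by positivity) (one_le_rpow ?_ ?_)
        · linarith [abs_nonneg (x j)]
        · have := hκ j
          positivity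

/-- The reflection of `ℝ^d` changing the sign of the coordinates `j` with `ε j = false`. -/
def signChange (ε : Fin d → Bool) (y : Fin d → ℝ) : Fin d → ℝ :=
  fun j => if ε j then y j else -y j

theorem signChange_signChange (ε : Fin d → Bool) (y : Fin d → ℝ) :
    signChange ε (signChange ε y) = y := by
  ext j
  by_cases h : ε j <;> simp [signChange, h]

theorem abs_signChange (ε : Fin d → Bool) (y : Fin d → ℝ) (j : Fin d) :
    |signChange ε y j| = |y j| := by
  by_cases h : ε j <;> simp [signChange, h]

theorem measurePreserving_signChange_volume (ε : Fin d → Bool) :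
    MeasurePreserving (signChange ε) volume volume := by
  refine volume_preserving_pi (f := fun j t => if ε j then t else -t) fun j => ?_
  by_cases h : ε j
  · simp only [h, if_true]
    exact MeasurePreserving.id volume
  · simpa [h] using Measure.measurePreserving_neg (volume : Measure ℝ)

theorem measurePreserving_signChange (κ : Fin d → ℝ) (ε : Fin d → Bool) :
    MeasurePreserving (signChange ε) (muK d κ) (muK d κ) := by
  have hmp := measurePreserving_signChange_volume ε
  refine ⟨hmp.measurable, Measure.ext fun s hs => ?_⟩
  rw [Measure.map_apply hmp.measurable hs, muK, withDensity_apply _ hs,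
    withDensity_apply _ (hmp.measurable hs),
    ← hmp.setLIntegral_comp_preimage hs (measurable_prod_abs_rpow κ)]
  simp only [abs_signChange]

theorem setOf_abs_mem_Rset_subset (x : Fin d → ℝ) {s : ℝ} (hs : 0 < s) :
    {y : Fin d → ℝ | (fun j => |y j|) ∈ Rset d x s} ⊆
      ⋃ ε : Fin d → Bool, signChange ε ⁻¹' ball x (2 * s) := by
  intro y hy
  refine mem_iUnion.2 ⟨fun j => decide (0 ≤ x j ↔ 0 ≤ y j), ?_⟩
  refine (dist_pi_lt_iff (by positivity)).2 fun j => ?_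
  have hj : |y j| ∈ Iset (x j) s := hy j (mem_univ j)
  have h1 : |x j| - s ≤ |y j| := (le_max_right _ _).trans hj.1
  have h2 : |y j| < |x j| + s := hj.2
  simp only [signChange, Real.dist_eq, decide_eq_true_eq]
  rw [abs_lt]
  rcases abs_cases (x j) with ⟨hx, hx'⟩ | ⟨hx, hx'⟩ <;>
    rcases abs_cases (y j) with ⟨hy, hy'⟩ | ⟨hy, hy'⟩ <;> split_ifs <;> grind

theorem MR_le (hκ : ∀ j, 0 ≤ κ j) {f : (Fin d → ℝ) → ℝ} (hf : Measurable f)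
    {G : (Fin d → ℝ) → ℝ≥0∞} (hG : ∀ ε y, ENNReal.ofReal |f (signChange ε y)| ≤ G y)
    (x : Fin d → ℝ) :
    MR d κ f x ≤ powerDoublingConst κ * 2 ^ d * uncenteredMax (muK d κ) G x := by
  refine iSup₂_le fun s hs => ?_
  have hint : ∫⁻ y in {y | (fun j => |y j|) ∈ Rset d x s}, ENNReal.ofReal |f y| ∂(muK d κ) ≤
      2 ^ d * ∫⁻ y in ball x (2 * s), G y ∂(muK d κ) := by
    calc ∫⁻ y in {y | (fun j => |y j|) ∈ Rset d x s}, ENNReal.ofReal |f y| ∂(muK d κ)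
        ≤ ∑' ε : Fin d → Bool, ∫⁻ y in signChange ε ⁻¹' ball x (2 * s),
            ENNReal.ofReal |f y| ∂(muK d κ) :=
          (lintegral_mono_set (setOf_abs_mem_Rset_subset x hs)).trans (lintegral_iUnion_le _ _)
      _ ≤ ∑' _ε : Fin d → Bool, ∫⁻ y in ball x (2 * s), G y ∂(muK d κ) := by
          refine ENNReal.tsum_le_tsum fun ε => ?_
          have hmp := measurePreserving_signChange κ ε
          have h := hmp.setLIntegral_comp_preimage (measurableSet_ball (x := x) (ε := 2 * s))
            (f := fun y => ENNReal.ofReal |f (signChange ε y)|)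
            (hf.comp hmp.measurable).abs.ennreal_ofReal
          simp only [signChange_signChange] at h
          rw [h]
          exact lintegral_mono (hG ε)
      _ = 2 ^ d * ∫⁻ y in ball x (2 * s), G y ∂(muK d κ) := by
          rw [tsum_fintype]
          simp
  have hball : muK d κ (ball x (2 * s)) ≤ powerDoublingConst κ * muK d κ (Rset d x s) :=
    (measure_mono ball_subset_closedBall).trans <|
      (muK_closedBall_two_mul_le hκ x hs).trans <| by gcongr; exact le_muK_Rset hκ x hs
  have hone : 1 ≤ powerDoublingConst κ := by
    rw [powerDoublingConst]
    refine Finset.one_le_prod' fun j _ => ?_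
    refine one_le_mul (by norm_num) (NNReal.one_le_rpow (by norm_num) ?_)
    have := hκ j
    positivity
  have hinv := GloballyDoubling.inv_le_const_mul_inv hone (n := 1) (by simpa using hball)
  rw [pow_one] at hinv
  calc (muK d κ (Rset d x s))⁻¹ *
        ∫⁻ y in {y | (fun j => |y j|) ∈ Rset d x s}, ENNReal.ofReal |f y| ∂(muK d κ)
      ≤ (powerDoublingConst κ * (muK d κ (ball x (2 * s)))⁻¹) *
        (2 ^ d * ∫⁻ y in ball x (2 * s), G y ∂(muK d κ)) := by gcongr
    _ = powerDoublingConst κ * 2 ^ d *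
        ((muK d κ (ball x (2 * s)))⁻¹ * ∫⁻ y in ball x (2 * s), G y ∂(muK d κ)) := by ring
    _ ≤ _ := by
        gcongr
        exact le_uncenteredMax _ _ (mem_ball_self (by positivity))

theorem ennreal_rpow_sum_le_sum_rpow {ι : Type*} (s : Finset ι) (a : ι → ℝ≥0∞) {p : ℝ}
    (hp0 : 0 < p) (hp1 : p ≤ 1) : (∑ i ∈ s, a i) ^ p ≤ ∑ i ∈ s, a i ^ p := by
  classical
  induction s using Finset.induction_on with
  | empty => simp [hp0]
  | insert i s his ih =>
    rw [Finset.sum_insert his, Finset.sum_insert his]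
    exact (ENNReal.rpow_add_le_add_rpow _ _ hp0.le hp1).trans (by gcongr)

/-- The `ℓ^r` norm of `f` over the orbit of a point under sign changes. -/
def orbitNorm (r : ℝ) (f : (Fin d → ℝ) → ℝ) (y : Fin d → ℝ) : ℝ≥0∞ :=
  (∑ ε : Fin d → Bool, ENNReal.ofReal |f (signChange ε y)| ^ r) ^ (1 / r)

theorem measurable_orbitNorm (r : ℝ) {f : (Fin d → ℝ) → ℝ} (hf : Measurable f) :
    Measurable (orbitNorm r f) :=
  (Finset.measurable_sum _ fun ε _ => ((hf.comp
    (measurePreserving_signChange_volume ε).measurable).abs.ennreal_ofReal.pow_const r)).pow_const _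

theorem le_orbitNorm {r : ℝ} (hr : 0 < r) (f : (Fin d → ℝ) → ℝ) (ε : Fin d → Bool)
    (y : Fin d → ℝ) : ENNReal.ofReal |f (signChange ε y)| ≤ orbitNorm r f y := by
  rw [orbitNorm, one_div, ENNReal.le_rpow_inv_iff hr]
  exact Finset.single_le_sum (f := fun ε => ENNReal.ofReal |f (signChange ε y)| ^ r)
    (fun _ _ => zero_le) (Finset.mem_univ ε)

theorem lintegral_tsum_orbitNorm_le {r : ℝ} (hr : 1 < r) {f : ℕ → (Fin d → ℝ) → ℝ}
    (hf : ∀ n, Measurable (f n)) :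
    ∫⁻ y, (∑' n, orbitNorm r (f n) y ^ r) ^ (1 / r) ∂(muK d κ) ≤
      2 ^ d * ∫⁻ y, (∑' n, ENNReal.ofReal |f n y| ^ r) ^ (1 / r) ∂(muK d κ) := by
  have hr0 : 0 < r := by linarith
  set F : (Fin d → ℝ) → ℝ≥0∞ := fun y => (∑' n, ENNReal.ofReal |f n y| ^ r) ^ (1 / r) with hF
  have hFm : Measurable F :=
    (Measurable.tsum fun n => (hf n).abs.ennreal_ofReal.pow_const r).pow_const _
  calc ∫⁻ y, (∑' n, orbitNorm r (f n) y ^ r) ^ (1 / r) ∂(muK d κ)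
      ≤ ∫⁻ y, ∑ ε : Fin d → Bool, F (signChange ε y) ∂(muK d κ) := by
        refine lintegral_mono fun y => ?_
        have h : ∑' n, orbitNorm r (f n) y ^ r =
            ∑ ε : Fin d → Bool, ∑' n, ENNReal.ofReal |f n (signChange ε y)| ^ r := by
          rw [← Summable.tsum_finsetSum fun _ _ => ENNReal.summable]
          refine tsum_congr fun n => ?_
          rw [orbitNorm, ← ENNReal.rpow_mul, one_div_mul_cancel hr0.ne', ENNReal.rpow_one]
        simp only [h]
        exact ennreal_rpow_sum_le_sum_rpow _ _ (by positivity) ((div_le_one hr0).2 hr.le)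
    _ = ∑ ε : Fin d → Bool, ∫⁻ y, F (signChange ε y) ∂(muK d κ) :=
        lintegral_finsetSum _ fun ε _ => hFm.comp (measurePreserving_signChange κ ε).measurable
    _ = 2 ^ d * ∫⁻ y, F y ∂(muK d κ) := by
        simp [(measurePreserving_signChange κ _).lintegral_comp hFm]

end PowerWeight

/-- Fefferman–Stein inequalities for `M_κ^R`: weak type `(1,1)`. -/
theorem fefferman_stein_MR_weak
    (d : ℕ) (hd : 1 ≤ d) (κ : Fin d → ℝ) (hκ : ∀ j, 0 ≤ κ j)
    (r : ℝ) (hr : 1 < r) :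
    ∃ C : ℝ, 0 < C ∧ ∀ f : ℕ → (Fin d → ℝ) → ℝ, (∀ n, Measurable (f n)) →
      (∫⁻ x, (∑' n, ENNReal.ofReal (|f n x|) ^ r) ^ (1/r) ∂(muK d κ)) < ∞ →
      ∀ lam : ℝ, 0 < lam →
      muK d κ {x | ENNReal.ofReal lam < (∑' n, MR d κ (f n) x ^ r) ^ (1/r)} ≤
        (ENNReal.ofReal C / ENNReal.ofReal lam) *
          ∫⁻ x, (∑' n, ENNReal.ofReal (|f n x|) ^ r) ^ (1/r) ∂(muK d κ) := by
  have hr0 : 0 < r := by linarith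
  have hdoubling := globallyDoubling_muK hd hκ
  have hone : 1 ≤ powerDoublingConst κ := hdoubling.one_le
  set D : ℝ≥0∞ := powerDoublingConst κ * 2 ^ d with hD
  have hD0 : D ≠ 0 := mul_ne_zero
    (by exact_mod_cast (zero_lt_one.trans_le hone).ne') (pow_ne_zero _ two_ne_zero)
  have hDtop : D ≠ ∞ := ENNReal.mul_ne_top ENNReal.coe_ne_top (by finiteness)
  set W : ℝ≥0∞ := GloballyDoubling.weakTypeConst (powerDoublingConst κ) r * D * 2 ^ d with hW
  have hWtop : W ≠ ∞ := ENNReal.mul_ne_top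
    (ENNReal.mul_ne_top (GloballyDoubling.weakTypeConst_ne_top hr) hDtop) (by finiteness)
  refine ⟨W.toReal + 1, by positivity, fun f hf hfin lam hlam => ?_⟩
  have hlam0 : ENNReal.ofReal lam ≠ 0 := (ENNReal.ofReal_pos.2 hlam).ne'
  have horbit := lintegral_tsum_orbitNorm_le (κ := κ) hr hf
  have hsub : {x | ENNReal.ofReal lam < (∑' n, MR d κ (f n) x ^ r) ^ (1 / r)} ⊆
      {x | ENNReal.ofReal lam / D <
        (∑' n, uncenteredMax (muK d κ) (orbitNorm r (f n)) x ^ r) ^ (1 / r)} := by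
    intro x hx
    refine ENNReal.div_lt_of_lt_mul' (lt_of_lt_of_le hx ?_)
    calc (∑' n, MR d κ (f n) x ^ r) ^ (1 / r)
        ≤ (∑' n, (D * uncenteredMax (muK d κ) (orbitNorm r (f n)) x) ^ r) ^ (1 / r) := by
          gcongr with n
          exact MR_le hκ (hf n) (le_orbitNorm hr0 (f n)) x
      _ = D * (∑' n, uncenteredMax (muK d κ) (orbitNorm r (f n)) x ^ r) ^ (1 / r) := by
          simp only [ENNReal.mul_rpow_of_nonneg _ _ hr0.le]
          rw [ENNReal.tsum_mul_left, ENNReal.mul_rpow_of_nonneg _ _ (by positivity),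
            ← ENNReal.rpow_mul, mul_one_div_cancel hr0.ne', ENNReal.rpow_one]
  calc muK d κ {x | ENNReal.ofReal lam < (∑' n, MR d κ (f n) x ^ r) ^ (1 / r)}
      ≤ GloballyDoubling.weakTypeConst (powerDoublingConst κ) r / (ENNReal.ofReal lam / D) *
          ∫⁻ x, (∑' n, orbitNorm r (f n) x ^ r) ^ (1 / r) ∂(muK d κ) :=
        (measure_mono hsub).trans <| hdoubling.measure_lt_tsum_uncenteredMax_le hone
          (fun n => measurable_orbitNorm r (hf n)) hr
          (horbit.trans_lt (ENNReal.mul_lt_top (by finiteness) hfin)).ne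
          (ENNReal.div_pos hlam0 hDtop).ne' (ENNReal.div_ne_top ENNReal.ofReal_ne_top hD0)
    _ ≤ GloballyDoubling.weakTypeConst (powerDoublingConst κ) r / (ENNReal.ofReal lam / D) *
          (2 ^ d * ∫⁻ x, (∑' n, ENNReal.ofReal |f n x| ^ r) ^ (1 / r) ∂(muK d κ)) := by
        gcongr
    _ = W / ENNReal.ofReal lam *
          ∫⁻ x, (∑' n, ENNReal.ofReal |f n x| ^ r) ^ (1 / r) ∂(muK d κ) := by
        rw [div_eq_mul_inv _ (_ / _),
          ENNReal.inv_div (Or.inl hDtop) (Or.inl hD0), hW]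
        simp only [div_eq_mul_inv]
        ring
    _ ≤ _ := by
        gcongr
        rw [← ENNReal.ofReal_toReal hWtop]
        exact ENNReal.ofReal_le_ofReal (by simp)
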